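/- arXiv:1501.01949 — 2 statements merged into one kernel-verified Lean document; each statement's English description precedes it below -/
import Mathlib

section
/- Let X be a first countable Tychonoff space. Then X is paracompact if and only if X is 𝒦(𝓜)-paracompact, normal, and countably paracompact. -/
open Set TopologicalSpace Topology

/-- A family of sets is locally finite at a point `x`: `x` has a neighborhood meeting
only finitely many members of the family. -/
def LocallyFiniteAt {X : Type*} [TopologicalSpace X] (x : X) (C : Set (Set X)) : Prop :=
  ∃ U ∈ nhds x, {A ∈ C | (A ∩ U).Nonempty}.Finite

/-- A family of sets is locally finite in `X`. -/
def LocallyFiniteFamily {X : Type*} [TopologicalSpace X] (C : Set (Set X)) : Prop :=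
  ∀ x : X, LocallyFiniteAt x C

/-- A poset is directed: every pair of elements has an upper bound. -/
def DirectedPoset (P : Type*) [Preorder P] : Prop :=
  ∀ a b : P, ∃ c : P, a ≤ c ∧ b ≤ c

/-- A poset has calibre (ω₁,ω) if every uncountable subset contains an infinite
subset with an upper bound. -/
def CalibreOmega1Omega (P : Type*) [Preorder P] : Prop :=
  ∀ S : Set P, ¬ S.Countable → ∃ T ⊆ S, T.Infinite ∧ ∃ b : P, ∀ t ∈ T, t ≤ b

/-- A collection `C` of subsets of `X` is `P`-locally finite. -/
def PLocallyFinite (P : Type*) [Preorder P] {X : Type*} [TopologicalSpace X]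
    (C : Set (Set X)) : Prop :=
  ∃ c : P → Set (Set X), (∀ p p' : P, p ≤ p' → c p ⊆ c p') ∧
    (∀ p, LocallyFiniteFamily (c p)) ∧ (⋃ p, c p) = C

def IsOpenCover {X : Type*} [TopologicalSpace X] (U : Set (Set X)) : Prop :=
  (∀ V ∈ U, IsOpen V) ∧ ⋃₀ U = univ

def IsRefinement {X : Type*} (V U : Set (Set X)) : Prop :=
  ∀ W ∈ V, ∃ W' ∈ U, W ⊆ W'

/-- `X` is `P`-paracompact: every open cover has a `P`-locally finite open refinement. -/
def PParacompact (P : Type*) [Preorder P] (X : Type*) [TopologicalSpace X] : Prop :=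
  ∀ U : Set (Set X), IsOpenCover U →
    ∃ V : Set (Set X), IsOpenCover V ∧ IsRefinement V U ∧ PLocallyFinite P V

/-- A collection is (ω₁,ω)-locally finite: every uncountable subcollection contains
an infinite locally finite subcollection. -/
def Omega1OmegaLF {X : Type*} [TopologicalSpace X] (C : Set (Set X)) : Prop :=
  ∀ D ⊆ C, ¬ D.Countable → ∃ E ⊆ D, E.Infinite ∧ LocallyFiniteFamily E

def Omega1OmegaParacompact (X : Type*) [TopologicalSpace X] : Prop :=
  ∀ U : Set (Set X), IsOpenCover U →
    ∃ V : Set (Set X), IsOpenCover V ∧ IsRefinement V U ∧ Omega1OmegaLF V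

/-- `B` is a base for the topology of `X`. -/
def IsBase {X : Type*} [TopologicalSpace X] (B : Set (Set X)) : Prop :=
  (∀ b ∈ B, IsOpen b) ∧ ∀ U : Set X, IsOpen U → ∀ x ∈ U, ∃ b ∈ B, x ∈ b ∧ b ⊆ U

/-- `X` is `P`-metrizable: it has a `(P × ℕ)`-locally finite base. -/
def PMetrizable (P : Type*) [Preorder P] (X : Type*) [TopologicalSpace X] : Prop :=
  ∃ B : Set (Set X), IsBase B ∧ PLocallyFinite (P × ℕ) B

def Omega1OmegaMetrizable (X : Type*) [TopologicalSpace X] : Prop :=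
  ∃ B : Set (Set X), IsBase B ∧ Omega1OmegaLF B

/-- Pseudocompact: every locally finite family of nonempty open sets is finite. -/
def Pseudocompact (X : Type*) [TopologicalSpace X] : Prop :=
  ∀ C : Set (Set X), (∀ U ∈ C, IsOpen U ∧ U.Nonempty) → LocallyFiniteFamily C → C.Finite

/-- The directed set of compact subsets of `M`, ordered by inclusion. -/
abbrev KM (M : Type*) [TopologicalSpace M] : Type _ := {K : Set M // IsCompact K}

/-- `X` is 𝒦(𝓜)-paracompact: every open cover has a `𝒦(M)`-locally finite open
refinement for some separable metrizable `M`. -/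
def KMclassParacompact (X : Type*) [TopologicalSpace X] : Prop :=
  ∀ U : Set (Set X), IsOpenCover U →
    ∃ (M : Type) (_ : TopologicalSpace M), SeparableSpace M ∧ MetrizableSpace M ∧
      ∃ V : Set (Set X), IsOpenCover V ∧ IsRefinement V U ∧ PLocallyFinite (KM M) V

/-- Weakly σ-locally finite collection. -/
def WeaklySigmaLF {X : Type*} [TopologicalSpace X] (C : Set (Set X)) : Prop :=
  ∃ c : ℕ → Set (Set X), (⋃ n, c n) = C ∧
    ∀ x : X, ∀ A ∈ C, ∃ n, A ∈ c n ∧ LocallyFiniteAt x (c n)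

/-- Relatively locally finite: locally finite at every point of its union. -/
def RelLocallyFinite {X : Type*} [TopologicalSpace X] (C : Set (Set X)) : Prop :=
  ∀ x ∈ ⋃₀ C, LocallyFiniteAt x C

def SigmaRelLF {X : Type*} [TopologicalSpace X] (C : Set (Set X)) : Prop :=
  ∃ c : ℕ → Set (Set X), (⋃ n, c n) = C ∧ ∀ n, RelLocallyFinite (c n)

def SigmaRelParacompact (X : Type*) [TopologicalSpace X] : Prop :=
  ∀ U : Set (Set X), IsOpenCover U →
    ∃ V : Set (Set X), IsOpenCover V ∧ IsRefinement V U ∧ SigmaRelLF V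

/-- An open set `U` is `P`-regular. -/
def PRegular (P : Type*) [Preorder P] {X : Type*} [TopologicalSpace X] (U : Set X) : Prop :=
  ∃ V : P × ℕ → Set X, (∀ q, IsOpen (V q)) ∧ (∀ q q' : P × ℕ, q ≤ q' → V q ⊆ V q') ∧
    (⋃ q, V q) = U ∧ (⋃ q, closure (V q)) = U

def PPerfectlyNormal (P : Type*) [Preorder P] (X : Type*) [TopologicalSpace X] : Prop :=
  ∀ U : Set X, IsOpen U → PRegular P U

/-- A development for `X`. -/
def IsDevelopment {X : Type*} [TopologicalSpace X] (G : ℕ → Set (Set X)) : Prop :=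
  (∀ n, IsOpenCover (G n)) ∧
    ∀ (x : X) (U : Set X), IsOpen U → x ∈ U → ∃ n, ⋃₀ {g ∈ G n | x ∈ g} ⊆ U

/-- A Moore space is a regular Hausdorff space with a development; here we record
just the existence of a development (regularity is a separate hypothesis). -/
def HasDevelopment (X : Type*) [TopologicalSpace X] : Prop :=
  ∃ G : ℕ → Set (Set X), IsDevelopment G

/-- Countably paracompact: every countable open cover has a locally finite open refinement. -/
def CountablyParacompact (X : Type*) [TopologicalSpace X] : Prop :=
  ∀ U : Set (Set X), IsOpenCover U → U.Countable →
    ∃ V : Set (Set X), IsOpenCover V ∧ IsRefinement V U ∧ LocallyFiniteFamily V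

/-- ccc: every pairwise disjoint family of nonempty open sets is countable. -/
def CCC (X : Type*) [TopologicalSpace X] : Prop :=
  ∀ C : Set (Set X), (∀ U ∈ C, IsOpen U ∧ U.Nonempty) → C.Pairwise Disjoint → C.Countable

/-- Cofinal subset of a preorder. -/
def CofinalSet {P : Type*} [Preorder P] (C : Set P) : Prop :=
  ∀ p : P, ∃ c ∈ C, p ≤ c

/-- `Q` is a Tukey quotient of `P`. -/
def TukeyQuotient (P : Type*) [Preorder P] (Q : Type*) [Preorder Q] : Prop :=
  ∃ φ : P → Q, ∀ C : Set P, CofinalSet C → CofinalSet (φ '' C)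
theorem aux_paracompact_refine {X : Type*} [TopologicalSpace X] [ParacompactSpace X]
    (U : Set (Set X)) (hU : _root_.IsOpenCover U) :
    ∃ V : Set (Set X), _root_.IsOpenCover V ∧ IsRefinement V U ∧ LocallyFiniteFamily V := by
  obtain ⟨t, ho, hc, hlf, hsub⟩ := precise_refinement (fun a : U => (a : Set X))
    (fun a => hU.1 a a.2) (by rw [← sUnion_eq_iUnion]; exact hU.2)
  refine ⟨range t, ⟨?_, ?_⟩, ?_, ?_⟩
  · rintro _ ⟨a, rfl⟩; exact ho a
  · rw [sUnion_range]; exact hc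
  · rintro _ ⟨a, rfl⟩; exact ⟨a, a.2, hsub a⟩
  · intro x
    obtain ⟨N, hN, hf⟩ := hlf x
    refine ⟨N, hN, (hf.image t).subset ?_⟩
    rintro _ ⟨⟨a, rfl⟩, h⟩
    exact ⟨a, h, rfl⟩

/-- A countable family of open sets that is a base of neighborhoods of all compact sets. -/
theorem aux_base (M : Type*) [TopologicalSpace M] [SecondCountableTopology M] :
    ∃ B : ℕ → Set M, (∀ n, IsOpen (B n)) ∧
      ∀ K U : Set M, IsCompact K → IsOpen U → K ⊆ U → ∃ n, K ⊆ B n ∧ B n ⊆ U := by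
  have hb := isBasis_countableBasis M
  have hcount : {F : Set (Set M) | F.Finite ∧ F ⊆ countableBasis M}.Countable :=
    countable_setOf_finite_subset (countable_countableBasis M)
  obtain ⟨g, hg⟩ := hcount.exists_eq_range ⟨∅, finite_empty, empty_subset _⟩
  refine ⟨fun n => ⋃₀ g n, ?_, ?_⟩
  · intro n
    have : g n ∈ {F : Set (Set M) | F.Finite ∧ F ⊆ countableBasis M} := hg ▸ mem_range_self n
    exact isOpen_sUnion fun s hs => hb.isOpen (this.2 hs)
  · intro K U hK hU hKU
    have : ∃ F : Set (Set M), (F.Finite ∧ F ⊆ countableBasis M) ∧ K ⊆ ⋃₀ F ∧ ⋃₀ F ⊆ U := by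
      refine hK.induction_on (p := fun s => ∃ F : Set (Set M),
        (F.Finite ∧ F ⊆ countableBasis M) ∧ s ⊆ ⋃₀ F ∧ ⋃₀ F ⊆ U) ?_ ?_ ?_ ?_
      · exact ⟨∅, ⟨finite_empty, empty_subset _⟩, by simp, by simp⟩
      · rintro s t hst ⟨F, h1, h2, h3⟩
        exact ⟨F, h1, hst.trans h2, h3⟩
      · rintro s t ⟨F, h1, h2, h3⟩ ⟨G, k1, k2, k3⟩
        refine ⟨F ∪ G, ⟨h1.1.union k1.1, union_subset h1.2 k1.2⟩, ?_, ?_⟩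
        · rw [sUnion_union]; exact union_subset_union h2 k2
        · rw [sUnion_union]; exact union_subset h3 k3
      · intro x hx
        obtain ⟨v, hv, hxv, hvU⟩ := hb.exists_subset_of_mem_open (hKU hx) hU
        exact ⟨v, mem_nhdsWithin_of_mem_nhds ((hb.isOpen hv).mem_nhds hxv), {v},
          ⟨finite_singleton v, by simpa using hv⟩, by simp, by simpa using hvU⟩
    obtain ⟨F, hF, h⟩ := this
    have : F ∈ range g := hg ▸ hF
    obtain ⟨n, rfl⟩ := this
    exact ⟨n, h⟩

theorem aux_compact {M : Type*} [TopologicalSpace M] (K : Set M) (L : ℕ → Set M)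
    (hK : IsCompact K) (hL : ∀ n, IsCompact (L n))
    (h : ∀ U, IsOpen U → K ⊆ U → ∃ N, ∀ n, N ≤ n → L n ⊆ U) :
    IsCompact (K ∪ ⋃ n, L n) := by
  classical
  refine isCompact_of_finite_subcover ?_
  intro ι U hU hc
  obtain ⟨t, ht⟩ := hK.elim_finite_subcover U hU (subset_union_left.trans hc)
  obtain ⟨N, hN⟩ := h _ (isOpen_biUnion fun i (_ : i ∈ t) => hU i) ht
  have hc2 : IsCompact (⋃ n ∈ Finset.range N, L n) :=
    (Finset.range N).isCompact_biUnion fun n _ => hL n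
  obtain ⟨t', ht'⟩ := hc2.elim_finite_subcover U hU
    ((iUnion₂_subset fun n _ => subset_iUnion L n).trans (subset_union_right.trans hc))
  refine ⟨t ∪ t', ?_⟩
  rw [Finset.set_biUnion_union]
  refine union_subset (ht.trans subset_union_left) (iUnion_subset fun n => ?_)
  rcases lt_or_ge n N with hn | hn
  · refine Subset.trans ?_ (ht'.trans subset_union_right)
    exact subset_biUnion_of_mem (u := L) (Finset.mem_coe.2 (Finset.mem_range.2 hn))
  · exact (hN n hn).trans subset_union_left

theorem aux_weakly {X : Type*} [TopologicalSpace X] [FirstCountableTopology X]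
    (M : Type*) [TopologicalSpace M] [SeparableSpace M] [MetrizableSpace M]
    (V : Set (Set X)) (hV : PLocallyFinite (KM M) V) :
    ∃ d : ℕ → Set (Set X), (∀ n, d n ⊆ V) ∧
      ∀ x : X, ∀ A ∈ V, ∃ n, A ∈ d n ∧ LocallyFiniteAt x (d n) := by
  letI := metrizableSpaceMetric M
  haveI : SecondCountableTopology M := UniformSpace.secondCountable_of_separable M
  obtain ⟨c, hmono, hlf, hcV⟩ := hV
  obtain ⟨B, -, hB⟩ := aux_base M
  have hex : ∀ A : Set X, ∃ K : KM M, A ∈ V → A ∈ c K := by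
    intro A
    by_cases hA : A ∈ V
    · rw [← hcV] at hA
      obtain ⟨K, hK⟩ := mem_iUnion.1 hA
      exact ⟨K, fun _ => hK⟩
    · exact ⟨⟨∅, isCompact_empty⟩, fun h => absurd h hA⟩
  choose κ hκ using hex
  refine ⟨fun n => {A ∈ V | (κ A : Set M) ⊆ B n}, fun n A h => h.1, ?_⟩
  intro x A hA
  by_contra hcon
  push Not at hcon
  let K : Set M := (κ A).1
  have hK : IsCompact K := (κ A).2
  have hn : ∀ k : ℕ, ∃ n, K ⊆ B n ∧ B n ⊆ Metric.thickening (1 / ((k : ℝ) + 1)) K := fun k =>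
    hB K _ hK Metric.isOpen_thickening (Metric.self_subset_thickening (by positivity) K)
  choose ν hν1 hν2 using hn
  obtain ⟨W, hW⟩ := (nhds x).exists_antitone_basis
  have hinf : ∀ k, {D | (D ∈ V ∧ (κ D : Set M) ⊆ B (ν k)) ∧ (D ∩ W k).Nonempty}.Infinite := by
    intro k hfin
    exact hcon (ν k) ⟨hA, hν1 k⟩ ⟨W k, hW.mem k, hfin⟩
  obtain ⟨f, hf1, hf2⟩ := exists_seq_of_forall_finset_exists
    (fun p : ℕ × Set X => (p.2 ∈ V ∧ (κ p.2 : Set M) ⊆ B (ν p.1)) ∧ (p.2 ∩ W p.1).Nonempty)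
    (fun p q => p.1 < q.1 ∧ p.2 ≠ q.2) (by
      classical
      intro s _
      obtain ⟨D, hD, hD'⟩ := (hinf (s.sup Prod.fst + 1)).exists_notMem_finset (s.image Prod.snd)
      refine ⟨(s.sup Prod.fst + 1, D), hD, fun p hp => ⟨?_, ?_⟩⟩
      · exact Nat.lt_succ_of_le (Finset.le_sup (f := Prod.fst) hp)
      · rintro rfl
        exact hD' (Finset.mem_image_of_mem _ hp))
  have hmonof : StrictMono fun n => (f n).1 := fun m n h => (hf2 m n h).1
  have hge : ∀ n, n ≤ (f n).1 := fun n => hmonof.id_le n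
  have hinj : Function.Injective fun n => (f n).2 := by
    intro m n h
    rcases lt_trichotomy m n with h' | h' | h'
    · exact absurd h (hf2 m n h').2
    · exact h'
    · exact absurd h.symm (hf2 n m h').2
  have hcomp : IsCompact (K ∪ ⋃ n, (κ (f n).2 : Set M)) := by
    refine aux_compact K _ hK (fun n => (κ (f n).2).2) ?_
    intro U hU hKU
    obtain ⟨δ, hδ, hsub⟩ := hK.exists_thickening_subset_open hU hKU
    obtain ⟨N, hN⟩ := exists_nat_one_div_lt hδ
    refine ⟨N, fun n hn => ?_⟩
    refine (hf1 n).1.2.trans ((hν2 _).trans (Subset.trans ?_ hsub))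
    refine Metric.thickening_mono (le_trans ?_ hN.le) K
    exact one_div_le_one_div_of_le (by positivity)
      (by have : (N : ℝ) ≤ ((f n).1 : ℝ) := by exact_mod_cast hn.trans (hge n)
          linarith)
  obtain ⟨U, hU, hfin⟩ := hlf ⟨_, hcomp⟩ x
  obtain ⟨k, -, hk⟩ := hW.1.mem_iff.1 hU
  refine (Ici_infinite k).image hinj.injOn (hfin.subset ?_)
  rintro _ ⟨n, hn, rfl⟩
  refine ⟨hmono (κ (f n).2) _ ?_ (hκ _ (hf1 n).1.1), (hf1 n).2.mono ?_⟩
  · exact (subset_iUnion (fun n => (κ (f n).2 : Set M)) n).trans subset_union_right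
  · exact inter_subset_inter_right _ ((hW.2 (le_trans hn (hge n))).trans hk)

/-- A countable open cover of a normal countably paracompact space has a precise locally
finite open refinement whose closures still refine the cover. -/
theorem aux_shrink {X : Type*} [TopologicalSpace X] [NormalSpace X]
    (hcp : CountablyParacompact X) (W : ℕ → Set X) (hWo : ∀ n, IsOpen (W n))
    (hWc : ⋃ n, W n = univ) :
    ∃ G : ℕ → Set X, (∀ n, IsOpen (G n)) ∧ ⋃ n, G n = univ ∧ LocallyFinite G ∧
      ∀ n, closure (G n) ⊆ W n := by
  obtain ⟨V, ⟨hVo, hVc⟩, hVr, hVlf⟩ := hcp (range W)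
    ⟨by rintro _ ⟨n, rfl⟩; exact hWo n, by rw [sUnion_range]; exact hWc⟩ (countable_range W)
  have hex : ∀ A : Set X, ∃ n, A ∈ V → A ⊆ W n := by
    intro A
    by_cases hA : A ∈ V
    · obtain ⟨_, ⟨n, rfl⟩, h⟩ := hVr A hA
      exact ⟨n, fun _ => h⟩
    · exact ⟨0, fun h => absurd h hA⟩
  choose i hi using hex
  let H : ℕ → Set X := fun n => ⋃₀ {A ∈ V | i A = n}
  have hHo : ∀ n, IsOpen (H n) := fun n => isOpen_sUnion fun A hA => hVo A hA.1
  have hHc : ⋃ n, H n = univ := by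
    refine eq_univ_of_forall fun x => ?_
    obtain ⟨A, hA, hx⟩ := mem_sUnion.1 (hVc ▸ mem_univ x : x ∈ ⋃₀ V)
    exact mem_iUnion.2 ⟨i A, A, ⟨hA, rfl⟩, hx⟩
  have hHlf : LocallyFinite H := by
    intro x
    obtain ⟨U, hU, hfin⟩ := hVlf x
    refine ⟨U, hU, (hfin.image i).subset ?_⟩
    rintro n ⟨y, ⟨A, ⟨hA, hAn⟩, hy⟩, hyU⟩
    exact ⟨A, ⟨hA, y, hy, hyU⟩, hAn⟩
  obtain ⟨G, hGc, hGo, hGs⟩ := exists_iUnion_eq_closure_subset hHo hHlf.point_finite hHc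
  refine ⟨G, hGo, hGc, hHlf.subset fun n => subset_closure.trans (hGs n), fun n => ?_⟩
  refine (hGs n).trans (sUnion_subset ?_)
  rintro A ⟨hA, rfl⟩
  exact hi A hA

theorem aux_main {X : Type*} [TopologicalSpace X] [NormalSpace X]
    (hcp : CountablyParacompact X) (V : Set (Set X)) (hV : _root_.IsOpenCover V)
    (d : ℕ → Set (Set X)) (hdV : ∀ n, d n ⊆ V)
    (hd : ∀ x : X, ∀ A ∈ V, ∃ n, A ∈ d n ∧ LocallyFiniteAt x (d n)) :
    ∃ t : (Σ n : ℕ, d n) → Set X, (∀ b, IsOpen (t b)) ∧ ⋃ b, t b = univ ∧ LocallyFinite t ∧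
      ∀ b, t b ⊆ b.2 := by
  have hOo : ∀ n, IsOpen {x | LocallyFiniteAt x (d n)} := by
    intro n
    rw [isOpen_iff_mem_nhds]
    rintro x ⟨U, hU, hfin⟩
    filter_upwards [eventually_mem_nhds_iff.2 hU] with y hy
    exact ⟨U, hy, hfin⟩
  obtain ⟨G, hGo, hGc, hGlf, hGs⟩ := aux_shrink hcp
    (fun n => {x | LocallyFiniteAt x (d n)} ∩ ⋃₀ d n)
    (fun n => (hOo n).inter (isOpen_sUnion fun A hA => hV.1 A (hdV n hA)))
    (by
      refine eq_univ_of_forall fun x => ?_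
      obtain ⟨A, hA, hx⟩ := mem_sUnion.1 (hV.2 ▸ mem_univ x : x ∈ ⋃₀ V)
      obtain ⟨n, hn, h⟩ := hd x A hA
      exact mem_iUnion.2 ⟨n, h, A, hn, hx⟩)
  refine ⟨fun b => b.2 ∩ G b.1, ?_, ?_, ?_, fun b => inter_subset_left⟩
  · exact fun b => (hV.1 _ (hdV _ b.2.2)).inter (hGo _)
  · refine eq_univ_of_forall fun x => ?_
    obtain ⟨n, hn⟩ := mem_iUnion.1 (hGc ▸ mem_univ x : x ∈ ⋃ n, G n)
    obtain ⟨A, hA, hxA⟩ := (hGs n (subset_closure hn)).2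
    exact mem_iUnion.2 ⟨⟨n, A, hA⟩, hxA, hn⟩
  · intro x
    obtain ⟨U, hU, hfin⟩ := hGlf x
    have key : ∀ n, ∃ N ∈ nhds x, {A : d n | (((A : Set X) ∩ G n) ∩ N).Nonempty}.Finite := by
      intro n
      by_cases hx : x ∈ closure (G n)
      · obtain ⟨N, hN, hf⟩ := (hGs n hx).1
        refine ⟨N, hN, Finite.of_finite_image (f := Subtype.val) (hf.subset ?_)
          Subtype.val_injective.injOn⟩
        rintro _ ⟨A, ⟨y, hy, hyN⟩, rfl⟩
        exact ⟨A.2, y, hy.1, hyN⟩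
      · refine ⟨(closure (G n))ᶜ, isClosed_closure.isOpen_compl.mem_nhds hx, ?_⟩
        refine finite_empty.subset ?_
        rintro A ⟨y, hy, hyN⟩
        exact hyN (subset_closure hy.2)
    choose N hN hNf using key
    refine ⟨U ∩ ⋂ n ∈ {n | (G n ∩ U).Nonempty}, N n,
      Filter.inter_mem hU ((Filter.biInter_mem hfin).2 fun n _ => hN n), ?_⟩
    refine (hfin.biUnion fun n _ => (hNf n).image (Sigma.mk n)).subset ?_
    rintro ⟨n, A⟩ ⟨y, hy, hyU, hyN⟩
    have hn : n ∈ {n | (G n ∩ U).Nonempty} := ⟨y, hy.2, hyU⟩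
    exact mem_biUnion hn ⟨A, ⟨y, hy, mem_iInter₂.1 hyN n hn⟩, rfl⟩

/-- A first countable Tychonoff space is paracompact if and only if it is
𝒦(𝓜)-paracompact, normal and countably paracompact. -/
theorem statement14 (X : Type*) [TopologicalSpace X] [T35Space X]
    [FirstCountableTopology X] :
    ParacompactSpace X ↔ (KMclassParacompact X ∧ NormalSpace X ∧ CountablyParacompact X) := by
  constructor
  · intro h
    refine ⟨?_, inferInstance, fun U hU _ => aux_paracompact_refine U hU⟩
    intro U hU
    obtain ⟨V, h1, h2, h3⟩ := aux_paracompact_refine U hU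
    refine ⟨Unit, inferInstance, inferInstance, inferInstance, V, h1, h2, fun _ => V,
      fun _ _ _ => Subset.rfl, fun _ => h3, ?_⟩
    haveI : Nonempty (KM Unit) := ⟨⟨∅, isCompact_empty⟩⟩
    exact iUnion_const V
  · rintro ⟨hkm, hn, hcp⟩
    refine ⟨fun α s hso hsc => ?_⟩
    obtain ⟨M, _, _, _, V, hV, hVr, hVlf⟩ := hkm (range s)
      ⟨by rintro _ ⟨a, rfl⟩; exact hso a, by rw [sUnion_range]; exact hsc⟩
    obtain ⟨d, hdV, hd⟩ := aux_weakly M V hVlf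
    obtain ⟨t, h1, h2, h3, h4⟩ := aux_main hcp V hV d hdV hd
    refine ⟨_, t, h1, h2, h3, fun b => ?_⟩
    obtain ⟨_, ⟨a, rfl⟩, h⟩ := hVr _ (hdV _ b.2.2)
    exact ⟨a, (h4 b).trans h⟩
end

section
/- Let X be a ccc Tychonoff space. If X is 𝒦(M)-metrizable for some separable metrizable space M, then X is metrizable. -/
open Set TopologicalSpace Topology

theorem aux_compact_net (M : Type*) [TopologicalSpace M] [SecondCountableTopology M] :
    ∃ V : ℕ → Set M, ∀ K U : Set M, IsCompact K → IsOpen U → K ⊆ U →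
      ∃ n, K ⊆ V n ∧ V n ⊆ U := by
  have hc : {S : Set (Set M) | S.Finite ∧ S ⊆ countableBasis M}.Countable :=
    Set.countable_setOf_finite_subset (countable_countableBasis M)
  have hne : {S : Set (Set M) | S.Finite ∧ S ⊆ countableBasis M}.Nonempty :=
    ⟨∅, Set.finite_empty, Set.empty_subset _⟩
  obtain ⟨f, hf⟩ := hc.exists_eq_range hne
  refine ⟨fun n => ⋃₀ f n, ?_⟩
  intro K U hK hU hKU
  have hb := isBasis_countableBasis M
  obtain ⟨t, hts, htf, htK⟩ := hK.elim_finite_subcover_image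
    (b := {W | W ∈ countableBasis M ∧ W ⊆ U}) (c := id)
    (fun W hW => hb.isOpen hW.1) (by
      intro x hx
      obtain ⟨W, hW, hxW, hWU⟩ := hb.exists_subset_of_mem_open (hKU hx) hU
      exact Set.mem_biUnion (x := W) ⟨hW, hWU⟩ hxW)
  have ht : t ∈ Set.range f := by
    rw [← hf]
    exact ⟨htf, fun W hW => (hts hW).1⟩
  obtain ⟨n, rfl⟩ := ht
  refine ⟨n, ?_, ?_⟩
  · intro x hx
    obtain ⟨W, hW, hxW⟩ := Set.mem_iUnion₂.1 (htK hx)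
    exact ⟨W, hW, hxW⟩
  · exact Set.sUnion_subset fun W hW => (hts hW).2

theorem aux_ccc {X : Type*} [TopologicalSpace X] (hccc : CCC X) (C : Set (Set X))
    (hC : ∀ A ∈ C, IsOpen A) :
    {A ∈ C | ∃ x ∈ A, LocallyFiniteAt x C}.Countable := by
  obtain ⟨F, hF⟩ := zorn_subset
    {F : Set (Set X) | (∀ G ∈ F, (IsOpen G ∧ G.Nonempty) ∧ {A ∈ C | (A ∩ G).Nonempty}.Finite) ∧
      F.Pairwise Disjoint} (by
      intro c hc hch
      refine ⟨⋃₀ c, ⟨?_, ?_⟩, fun s hs => Set.subset_sUnion_of_mem hs⟩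
      · rintro G ⟨s, hs, hG⟩
        exact (hc hs).1 G hG
      · exact (Set.pairwise_sUnion hch.directedOn).2 fun s hs => (hc hs).2)
  have hFc : F.Countable := hccc F (fun G hG => (hF.prop.1 G hG).1) hF.prop.2
  refine (hFc.biUnion (t := fun G _ => {A ∈ C | (A ∩ G).Nonempty})
    fun G hG => (hF.prop.1 G hG).2.countable).mono ?_
  rintro A ⟨hA, x, hxA, U, hU, hfin⟩
  by_contra hcon
  have hdisj : ∀ G ∈ F, Disjoint A G := by
    intro G hG
    rw [Set.disjoint_iff_inter_eq_empty]
    by_contra hne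
    exact hcon (Set.mem_biUnion hG ⟨hA, Set.nonempty_iff_ne_empty.2 hne⟩)
  have hUi : x ∈ interior U := mem_interior_iff_mem_nhds.2 hU
  have hmem : A ∩ interior U ∈ F := by
    refine hF.le_of_ge (y := insert (A ∩ interior U) F) ⟨?_, ?_⟩ (Set.subset_insert _ _)
      (Set.mem_insert _ _)
    · rintro G (rfl | hG)
      · refine ⟨⟨(hC A hA).inter isOpen_interior, x, hxA, hUi⟩, hfin.subset ?_⟩
        rintro A' ⟨hA', y, hy, -, hyU⟩
        exact ⟨hA', y, hy, interior_subset hyU⟩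
      · exact hF.prop.1 G hG
    · refine hF.prop.2.insert ?_
      intro G hG _
      have h4 : Disjoint (A ∩ interior U) G := (hdisj G hG).mono_left Set.inter_subset_left
      exact ⟨h4, h4.symm⟩
  exact Set.disjoint_left.1 (hdisj _ hmem) hxA ⟨hxA, hUi⟩

theorem aux_key {X M : Type*} [TopologicalSpace X] [TopologicalSpace M]
    (V : ℕ → Set M) (hV : ∀ K U : Set M, IsCompact K → IsOpen U → K ⊆ U →
      ∃ n, K ⊆ V n ∧ V n ⊆ U)
    (c : KM M × ℕ → Set (Set X)) (hmono : ∀ p p', p ≤ p' → c p ⊆ c p')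
    (hlf : ∀ p, LocallyFiniteFamily (c p)) (B : Set (Set X))
    (k : Set X → KM M × ℕ) (hk : ∀ A ∈ B, A ∈ c (k A)) (x : X) (U : ℕ → Set X)
    (hU : ∀ O ∈ nhds x, ∃ j₀, ∀ j, j₀ ≤ j → U j ⊆ O) (A : Set X) :
    ∃ (s : Finset ℕ) (j : ℕ), (∀ i ∈ s, (k A).1.1 ⊆ V i) ∧
      {A' ∈ {A' ∈ B | (∀ i ∈ s, (k A').1.1 ⊆ V i) ∧ (k A').2 = (k A).2} |
        (A' ∩ U j).Nonempty}.Finite := by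
  classical
  by_contra! hcon
  have h1 : ∀ j : ℕ, ∃ T : Finset (Set X), (T : Set (Set X)) ⊆
      {A' ∈ {A' ∈ B | (∀ i ∈ (Finset.range j).filter (fun i => (k A).1.1 ⊆ V i),
        (k A').1.1 ⊆ V i) ∧ (k A').2 = (k A).2} | (A' ∩ U j).Nonempty} ∧ T.card = j := by
    intro j
    refine Set.Infinite.exists_subset_card_eq ?_ j
    exact hcon _ j fun i hi => (Finset.mem_filter.1 hi).2
  choose T hT hTc using h1
  have hK : IsCompact ((k A).1.1 ∪ ⋃ j, ⋃ A' ∈ T j, (k A').1.1) := by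
    rw [isCompact_iff_finite_subcover]
    intro ι W hW hcov
    obtain ⟨t, ht⟩ := (k A).1.2.elim_finite_subcover W hW (Set.subset_union_left.trans hcov)
    obtain ⟨n, hn1, hn2⟩ := hV _ _ (k A).1.2 (isOpen_biUnion fun i _ => hW i) ht
    have hK2 : IsCompact (⋃ j ∈ Finset.range (n + 1), ⋃ A' ∈ T j, (k A').1.1) :=
      Finset.isCompact_biUnion _ fun j _ => Finset.isCompact_biUnion _ fun A' _ => (k A').1.2
    obtain ⟨t', ht'⟩ := hK2.elim_finite_subcover W hW (by
      refine Set.Subset.trans ?_ hcov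
      refine Set.Subset.trans ?_ Set.subset_union_right
      exact Set.iUnion₂_subset fun j _ => Set.subset_iUnion (fun j => ⋃ A' ∈ T j, (k A').1.1) j)
    refine ⟨t ∪ t', ?_⟩
    have e1 : (⋃ i ∈ t, W i) ⊆ ⋃ i ∈ t ∪ t', W i :=
      Set.biUnion_subset_biUnion_left fun i hi => Finset.mem_union_left _ hi
    have e2 : (⋃ i ∈ t', W i) ⊆ ⋃ i ∈ t ∪ t', W i :=
      Set.biUnion_subset_biUnion_left fun i hi => Finset.mem_union_right _ hi
    refine Set.union_subset (ht.trans e1) (Set.iUnion_subset fun j => ?_)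
    by_cases hj : j < n + 1
    · refine Set.Subset.trans ?_ (ht'.trans e2)
      exact Set.subset_biUnion_of_mem (u := fun j => ⋃ A' ∈ T j, (k A').1.1)
        (show j ∈ (Finset.range (n + 1) : Set ℕ) by simpa using hj)
    · refine Set.iUnion₂_subset fun A' hA' => ?_
      refine Set.Subset.trans ?_ (hn2.trans e1)
      exact (hT j hA').1.2.1 n (Finset.mem_filter.2 ⟨Finset.mem_range.2 (by omega), hn1⟩)
  obtain ⟨O, hO, hfin⟩ := hlf (⟨_, hK⟩, (k A).2) x
  obtain ⟨j₀, hj₀⟩ := hU O hO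
  have hsub : ∀ j, j₀ ≤ j → T j ⊆ hfin.toFinset := by
    intro j hj A' hA'
    rw [Set.Finite.mem_toFinset]
    have h2 := hT j hA'
    refine ⟨hmono (k A') _ ?_ (hk A' h2.1.1), h2.2.mono
      (Set.inter_subset_inter_right _ (hj₀ j hj))⟩
    refine ⟨?_, h2.1.2.2.le⟩
    intro y hy
    exact Or.inr (Set.mem_iUnion.2 ⟨j, Set.mem_iUnion₂.2 ⟨A', hA', hy⟩⟩)
  have h3 := Finset.card_le_card (hsub (j₀ + hfin.toFinset.card + 1) (by omega))
  rw [hTc] at h3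
  omega

/-- A ccc Tychonoff space which is `𝒦(M)`-metrizable for some separable
metrizable `M` is metrizable. -/
theorem statement17 (X : Type*) [TopologicalSpace X] [T35Space X]
    (hccc : CCC X)
    (h : ∃ (M : Type) (_ : TopologicalSpace M), SeparableSpace M ∧ MetrizableSpace M ∧
      PMetrizable (KM M) X) :
    MetrizableSpace X := by
  obtain ⟨M, tM, hsep, hmet, B, ⟨hBo, hBb⟩, c, hmono, hlf, hcB⟩ := h
  letI := metrizableSpaceMetric M
  haveI : SecondCountableTopology M := UniformSpace.secondCountable_of_separable M
  obtain ⟨V, hV⟩ := aux_compact_net M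
  have hk0 : ∀ A : Set X, ∃ p, A ∈ B → A ∈ c p := by
    intro A
    by_cases hA : A ∈ B
    · rw [← hcB] at hA
      obtain ⟨p, hp⟩ := Set.mem_iUnion.1 hA
      exact ⟨p, fun _ => hp⟩
    · exact ⟨(⟨∅, isCompact_empty⟩, 0), fun h => absurd h hA⟩
  choose k hk using hk0
  have hbasis : IsTopologicalBasis B := by
    refine isTopologicalBasis_of_isOpen_of_nhds hBo ?_
    intro a u ha hu
    obtain ⟨b, hb, h1, h2⟩ := hBb u hu a ha
    exact ⟨b, hb, h1, h2⟩
  have key := aux_key V hV c hmono hlf B k hk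
  -- point-countability
  have hpt : ∀ x : X, {A ∈ B | x ∈ A}.Countable := by
    intro x
    have hc : (⋃ q ∈ {q : Finset ℕ × ℕ | {A' ∈ {A' ∈ B | (∀ i ∈ q.1, (k A').1.1 ⊆ V i) ∧
        (k A').2 = q.2} | (A' ∩ {x}).Nonempty}.Finite},
        {A' ∈ {A' ∈ B | (∀ i ∈ q.1, (k A').1.1 ⊆ V i) ∧
        (k A').2 = q.2} | (A' ∩ {x}).Nonempty}).Countable :=
      (Set.to_countable _).biUnion fun q hq => Set.Finite.countable hq
    refine hc.mono ?_
    rintro A ⟨hA, hxA⟩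
    obtain ⟨s, j, hs, hfin⟩ := key x (fun _ => {x})
      (fun O hO => ⟨0, fun j _ => Set.singleton_subset_iff.2 (mem_of_mem_nhds hO)⟩) A
    exact Set.mem_biUnion (x := (s, (k A).2)) hfin ⟨⟨hA, hs, rfl⟩, x, hxA, rfl⟩
  have hBc : B.Countable := by
    have hc : ({∅} ∪ ⋃ q : Finset ℕ × ℕ,
        {A ∈ {A' ∈ B | (∀ i ∈ q.1, (k A').1.1 ⊆ V i) ∧ (k A').2 = q.2} |
          ∃ x ∈ A, LocallyFiniteAt x {A' ∈ B | (∀ i ∈ q.1, (k A').1.1 ⊆ V i) ∧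
            (k A').2 = q.2}}).Countable :=
      (Set.countable_singleton _).union (Set.countable_iUnion fun q =>
        aux_ccc hccc _ fun A hA => hBo A hA.1)
    refine hc.mono ?_
    intro A hA
    rcases A.eq_empty_or_nonempty with rfl | ⟨x, hx⟩
    · exact Or.inl rfl
    · right
      haveI : (nhds x).IsCountablyGenerated := by
        have hb := hbasis.nhds_hasBasis (a := x)
        exact Filter.HasCountableBasis.isCountablyGenerated ⟨hb, hpt x⟩
      obtain ⟨U, hU⟩ := (nhds x).exists_antitone_basis
      obtain ⟨s, j, hs, hfin⟩ := key x U (fun O hO => by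
        obtain ⟨j, -, hj⟩ := hU.1.mem_iff.1 hO
        exact ⟨j, fun i hi => (hU.2 hi).trans hj⟩) A
      exact Set.mem_iUnion.2 ⟨(s, (k A).2), ⟨hA, hs, rfl⟩, x, hx, U j, hU.1.mem_of_mem trivial, hfin⟩
  haveI : SecondCountableTopology X := hbasis.secondCountableTopology hBc
  exact metrizableSpace_of_t3_secondCountable X
end
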